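/- Let G be a 4-angry graph. Then the following assertions are equivalent: (1) there are two tetra-separations of G that cross with all four links empty; (2) G is a sprinkled K_{4,m} for some m ≥ 4. -/

import Mathlib

open Set

namespace Paper

variable {V : Type*}

/-- The set of edges of `G` with one endvertex in `A \ B` and the other in `B \ A`. -/
def sepEdges (G : SimpleGraph V) (A B : Set V) : Set (Sym2 V) :=
  {e | e ∈ G.edgeSet ∧ ∃ a b : V, e = s(a, b) ∧ a ∈ A \ B ∧ b ∈ B \ A}

/-- The order of the mixed-separation `(A, B)`: the number of vertices of `A ∩ B`
plus the number of edges between `A \ B` and `B \ A`. -/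
noncomputable def sepOrder (G : SimpleGraph V) (A B : Set V) : ℕ∞ :=
  (A ∩ B).encard + (sepEdges G A B).encard

/-- A mixed-separation⁺: a pair of vertex sets covering the whole graph. -/
def IsMixedSepPlus (A B : Set V) : Prop := A ∪ B = Set.univ

/-- A (proper) mixed-separation. -/
def IsMixedSep (A B : Set V) : Prop :=
  A ∪ B = Set.univ ∧ (A \ B).Nonempty ∧ (B \ A).Nonempty

/-- `G` is `k`-connected: it has more than `k` vertices and deleting fewer than `k`
vertices keeps it connected. -/
def KConnected (G : SimpleGraph V) (k : ℕ) : Prop :=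
  (k : ℕ∞) < (Set.univ : Set V).encard ∧
    ∀ X : Set V, X.encard < (k : ℕ∞) → (G.induce (Xᶜ : Set V)).Connected

/-- Every vertex of `A ∩ B` has at least two neighbours in `A \ B`
and at least two neighbours in `B \ A`. -/
def DegreeCondition (G : SimpleGraph V) (A B : Set V) : Prop :=
  ∀ v ∈ A ∩ B,
    2 ≤ (G.neighborSet v ∩ (A \ B)).encard ∧ 2 ≤ (G.neighborSet v ∩ (B \ A)).encard

/-- No two edges in the separator of `(A,B)` share an endvertex. -/
def MatchingCondition (G : SimpleGraph V) (A B : Set V) : Prop :=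
  ∀ e ∈ sepEdges G A B, ∀ f ∈ sepEdges G A B, e ≠ f → ∀ v : V, v ∈ e → v ∉ f

/-- A tetra-separation. -/
def IsTetraSep (G : SimpleGraph V) (A B : Set V) : Prop :=
  IsMixedSep A B ∧ sepOrder G A B = 4 ∧ DegreeCondition G A B ∧ MatchingCondition G A B

/-- `(A,B) ≤ (C,D)`. -/
def LeSep (A B C D : Set V) : Prop := A ⊆ C ∧ D ⊆ B

/-- `(A,B)` and `(C,D)` are nested. -/
def Nested (A B C D : Set V) : Prop :=
  LeSep A B C D ∨ LeSep A B D C ∨ LeSep B A C D ∨ LeSep B A D C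

/-- `(A,B)` and `(C,D)` cross. -/
def Crosses (A B C D : Set V) : Prop := ¬ Nested A B C D

/-- The corner for the sides `A` and `C` of the pair `(A,B)`, `(C,D)`. -/
def corner (A B C D : Set V) : Set V := (A \ B) ∩ (C \ D)

/-- The vertex-centre of the crossing-diagram of `(A,B)` and `(C,D)`. -/
def vertexCentre (A B C D : Set V) : Set V := A ∩ B ∩ C ∩ D

/-- An edge is diagonal if its endvertices lie in opposite corners. -/
def IsDiagonal (G : SimpleGraph V) (A B C D : Set V) (e : Sym2 V) : Prop :=
  e ∈ G.edgeSet ∧ ∃ a b : V, e = s(a, b) ∧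
    ((a ∈ corner A B C D ∧ b ∈ corner B A D C) ∨
     (a ∈ corner A B D C ∧ b ∈ corner B A C D))

/-- The `C`-link of the crossing diagram of `(A,B)` and `(C,D)`: all non-diagonal
edges of `S(A,B)` with an endvertex in the corner for `AC` or for `BC`, together with
all vertices of `(C \ D) ∩ S(A,B)`.  (The `D`-link is `link G A B D C`, the `A`-link
is `link G C D A B`, the `B`-link is `link G C D B A`.) -/
def link (G : SimpleGraph V) (A B C D : Set V) : Set (V ⊕ Sym2 V) :=
  Sum.inl '' ((C \ D) ∩ (A ∩ B)) ∪
    Sum.inr '' {e | e ∈ sepEdges G A B ∧ ¬ IsDiagonal G A B C D e ∧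
      ∃ v : V, v ∈ e ∧ (v ∈ corner A B C D ∨ v ∈ corner B A C D)}

/-- The centre: the vertex-centre together with all diagonal edges. -/
def centre (G : SimpleGraph V) (A B C D : Set V) : Set (V ⊕ Sym2 V) :=
  Sum.inl '' vertexCentre A B C D ∪ Sum.inr '' {e | IsDiagonal G A B C D e}

/-- The corner-separator `L(A,C)`: the union of the `A`-link, the `C`-link, the
vertex-centre and the diagonal edges with an endvertex in the corner for `AC`. -/
def cornerSep (G : SimpleGraph V) (A B C D : Set V) : Set (V ⊕ Sym2 V) :=
  link G C D A B ∪ link G A B C D ∪ Sum.inl '' vertexCentre A B C D ∪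
    Sum.inr '' {e | IsDiagonal G A B C D e ∧ ∃ v : V, v ∈ e ∧ v ∈ corner A B C D}

/-- An edge is jumping if its endvertices lie in opposite links. -/
def IsJumping (G : SimpleGraph V) (A B C D : Set V) (e : Sym2 V) : Prop :=
  e ∈ G.edgeSet ∧ ∃ a b : V, e = s(a, b) ∧
    ((Sum.inl a ∈ link G C D A B ∧ Sum.inl b ∈ link G C D B A) ∨
     (Sum.inl a ∈ link G A B C D ∧ Sum.inl b ∈ link G A B D C))

/-- An edge dangles from `fromLink` through `throughLink` if it has an endvertex
that is a vertex of `fromLink` and the edge itself is an element of `throughLink`. -/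
def DanglesFromThrough (G : SimpleGraph V) (fromLink throughLink : Set (V ⊕ Sym2 V))
    (e : Sym2 V) : Prop :=
  e ∈ G.edgeSet ∧ (∃ v : V, v ∈ e ∧ Sum.inl v ∈ fromLink) ∧ Sum.inr e ∈ throughLink

/-- The corner for `A` and `C` is potter. -/
def Potter (G : SimpleGraph V) (A B C D : Set V) : Prop :=
  corner A B C D = ∅ ∧ (link G C D A B).encard = 2 ∧ (link G A B C D).encard = 2 ∧
    ∃ u₁ u₂ u₃ u₄ : V, G.Adj u₁ u₂ ∧ G.Adj u₂ u₃ ∧ G.Adj u₃ u₄ ∧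
      List.Nodup [u₁, u₂, u₃, u₄] ∧
      Sum.inl u₂ ∈ link G A B C D ∧ Sum.inr (s(u₁, u₂)) ∈ link G C D A B ∧
      Sum.inl u₃ ∈ link G C D A B ∧ Sum.inr (s(u₃, u₄)) ∈ link G A B C D

/-- All four links have size two and the centre is empty. -/
def LinksTwoCentreEmpty (G : SimpleGraph V) (A B C D : Set V) : Prop :=
  (link G C D A B).encard = 2 ∧ (link G C D B A).encard = 2 ∧
    (link G A B C D).encard = 2 ∧ (link G A B D C).encard = 2 ∧
    centre G A B C D = ∅

/-- `(A,B)` is half-connected. -/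
def HalfConnected (G : SimpleGraph V) (A B : Set V) : Prop :=
  (G.induce (A \ B)).Connected ∨ (G.induce (B \ A)).Connected

/-- First component of the left-reduction of `(A,B)`: delete from `A` the vertices of
`A ∩ B` with at most one neighbour in `A \ B`.  (The left-reduction of `(A,B)` is
`(leftRed G A B, B)`; the right-reduction is `(A, leftRed G B A)`.) -/
def leftRed (G : SimpleGraph V) (A B : Set V) : Set V :=
  A \ {v | v ∈ A ∩ B ∧ (G.neighborSet v ∩ (A \ B)).encard ≤ 1}

/-- The separator of `(A,B)` as a set of vertices and edges. -/
def sepElems (G : SimpleGraph V) (A B : Set V) : Set (V ⊕ Sym2 V) :=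
  Sum.inl '' (A ∩ B) ∪ Sum.inr '' sepEdges G A B

/-- `x̂`: the endvertices of an element of the separator. -/
def hat : V ⊕ Sym2 V → Set V
  | Sum.inl v => {v}
  | Sum.inr e => {w | w ∈ e}

/-- `X̂` for a set `X` of vertices and edges. -/
def hatSet (π : Set (V ⊕ Sym2 V)) : Set V := ⋃ x ∈ π, hat x

/-- Inner vertices of a walk. -/
def innerVerts (G : SimpleGraph V) {u v : V} (p : G.Walk u v) : Set V :=
  {w | w ∈ p.support ∧ w ≠ u ∧ w ≠ v}

/-- An `X`–`Y` path: a path starting in `X`, ending in `Y`, with no other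
vertex in `X ∪ Y`. -/
def IsXYPath (G : SimpleGraph V) (X Y : Set V) {u v : V} (p : G.Walk u v) : Prop :=
  p.IsPath ∧ u ∈ X ∧ v ∈ Y ∧ ∀ w ∈ p.support, w ∈ X ∪ Y → w = u ∨ w = v

/-- A walk avoids a vertex (it is not on the walk) or an edge (it is not used). -/
def WalkAvoids (G : SimpleGraph V) {u v : V} (p : G.Walk u v) (x : V ⊕ Sym2 V) : Prop :=
  Sum.elim (fun w => w ∉ p.support) (fun e => e ∉ p.edges) x

/-- There are `n` pairwise independent `X`–`Y` paths in `G`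
(no path contains an inner vertex of another). -/
def HasIndepPaths (G : SimpleGraph V) (X Y : Set V) (n : ℕ) : Prop :=
  ∃ (a b : Fin n → V) (p : ∀ i, G.Walk (a i) (b i)),
    (∀ i, IsXYPath G X Y (p i)) ∧
      ∀ i j, i ≠ j → ∀ w ∈ innerVerts G (p i), w ∉ (p j).support

/-- Maximum number of pairwise independent `X`–`Y` paths in `G`. -/
noncomputable def maxIndepPaths (G : SimpleGraph V) (X Y : Set V) : ℕ∞ :=
  sSup {n : ℕ∞ | ∃ m : ℕ, n = (m : ℕ∞) ∧ HasIndepPaths G X Y m}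

/-- `(A,B)` strongly separates `X` and `Y`. -/
def StronglySeparates (A B X Y : Set V) : Prop := X ⊆ A \ B ∧ Y ⊆ B \ A

/-- Minimum order of a mixed-separation of `G` strongly separating `X` and `Y`. -/
noncomputable def minSepOrder (G : SimpleGraph V) (X Y : Set V) : ℕ∞ :=
  sInf {n : ℕ∞ | ∃ A B : Set V,
    IsMixedSep A B ∧ StronglySeparates A B X Y ∧ sepOrder G A B = n}

/-- A `k`-separation: a mixed-separation of order `k` whose separator has no edges. -/
def IsVertexSep (G : SimpleGraph V) (A B : Set V) (k : ℕ) : Prop :=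
  IsMixedSep A B ∧ sepEdges G A B = ∅ ∧ sepOrder G A B = (k : ℕ∞)

/-- `G` is quasi-`k`-connected: `(k-1)`-connected and every `(k-1)`-separation has a
side whose proper part is a single vertex. -/
def QuasiConnected (G : SimpleGraph V) (k : ℕ) : Prop :=
  KConnected G (k - 1) ∧
    ∀ A B : Set V, IsVertexSep G A B (k - 1) →
      (A \ B).encard = 1 ∨ (B \ A).encard = 1

/-- `{x₁,x₂}` is 3-linked around the separator `{x₁,x₂,x₃,x₄}`. -/
def ThreeLinkedAround (G : SimpleGraph V) (x₁ x₂ x₃ x₄ : V ⊕ Sym2 V) : Prop :=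
  (∃ e : Sym2 V, x₃ = Sum.inr e) ∨ (∃ e : Sym2 V, x₄ = Sum.inr e) ∨
    (((∃ v : V, x₁ = Sum.inl v) ∨ (∃ v : V, x₂ = Sum.inl v)) ∧
      ∃ a b : V, G.Adj a b ∧ a ∈ hat x₁ ∧ b ∈ hat x₂) ∨
    (∃ (a b : Fin 3 → V) (p : ∀ i, G.Walk (a i) (b i)),
      (∀ i, IsXYPath G (hat x₁) (hat x₂) (p i) ∧
        WalkAvoids G (p i) x₃ ∧ WalkAvoids G (p i) x₄) ∧
      ∀ i j, i ≠ j → ∀ w ∈ innerVerts G (p i), w ∉ (p j).support)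

/-- `G` is 4-angry: 4-connected and every tetra-separation is crossed. -/
def FourAngry (G : SimpleGraph V) : Prop :=
  KConnected G 4 ∧
    ∀ A B : Set V, IsTetraSep G A B → ∃ C D : Set V, IsTetraSep G C D ∧ Crosses A B C D

/-- `G` is a sprinkled `K₄,ₘ`: a set `X` of four vertices, whose complement has
exactly `m` elements, is independent and completely joined to `X`
(edges inside `X` arbitrary). -/
def IsSprinkledK4m (G : SimpleGraph V) (m : ℕ∞) : Prop :=
  ∃ X : Set V, X.encard = 4 ∧ (Xᶜ : Set V).encard = m ∧
    (∀ a b : V, a ∉ X → b ∉ X → ¬ G.Adj a b) ∧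
    ∀ a : V, a ∉ X → ∀ x ∈ X, G.Adj a x

/-- `K` is nonempty, disjoint from `Z`, and all neighbours of `K` lie in `K ∪ Z`;
that is, `K` is a nonempty union of components of `G - Z`. -/
structure IsZone (G : SimpleGraph V) (Z K : Set V) : Prop where
  nonempty : K.Nonempty
  notMem : ∀ v ∈ K, v ∉ Z
  closed : ∀ a ∈ K, ∀ b, G.Adj a b → b ∈ K ∨ b ∈ Z

/-- The elements of the separator of `(C, D)` that meet the vertex set `K`. -/
def touching (G : SimpleGraph V) (C D K : Set V) : Set (V ⊕ Sym2 V) :=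
  {x ∈ sepElems G C D | ∃ v ∈ hat x, v ∈ K}

theorem KConnected.false_of_separates {G : SimpleGraph V} (hG : KConnected G 4) {X P : Set V}
    (hX : X.encard < 4) {p q : V} (hp : p ∈ P) (hpX : p ∉ X) (hq : q ∉ P) (hqX : q ∉ X)
    (hcl : ∀ a ∈ P, a ∉ X → ∀ b, G.Adj a b → b ∈ P ∨ b ∈ X) : False := by
  have hc := (hG.2 X hX).preconnected ⟨p, hpX⟩ ⟨q, hqX⟩
  rw [SimpleGraph.reachable_iff_reflTransGen] at hc
  have key : ∀ w : (Xᶜ : Set V),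
      Relation.ReflTransGen (G.induce (Xᶜ : Set V)).Adj ⟨p, hpX⟩ w → w.1 ∈ P := by
    intro w hw
    induction hw with
    | refl => exact hp
    | @tail b c _ hbc ih => exact (hcl b ih b.2 c hbc).resolve_right c.2
  exact hq (key _ hc)

theorem IsZone.exists_adj {G : SimpleGraph V} (hG : KConnected G 4) {Z K : Set V}
    (hZ : Z.encard = 4) (hK : IsZone G Z K) {q : V} (hqK : q ∉ K) (hqZ : q ∉ Z) {z : V}
    (hz : z ∈ Z) : ∃ b ∈ K, G.Adj z b := by
  by_contra! h
  obtain ⟨p, hp⟩ := hK.nonempty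
  have hcard : (Z \ {z}).encard + 1 = 4 := by
    rw [encard_sdiff_singleton_add_one hz, hZ]
  have hlt : (Z \ {z}).encard < 4 := by
    have hfin : (Z \ {z}).encard ≠ ⊤ := by
      intro ht
      rw [ht] at hcard
      exact absurd hcard (by decide)
    rw [← hcard]
    exact (ENat.lt_add_one_iff hfin).2 le_rfl
  refine hG.false_of_separates hlt hp (fun h' => hK.notMem p hp h'.1) hqK (fun h' => hqZ h'.1) ?_
  intro a ha _ b hab
  rcases hK.closed a ha b hab with hb | hb
  · exact Or.inl hb
  · refine Or.inr ⟨hb, ?_⟩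
    rintro rfl
    exact h a ha hab.symm

theorem sepEdges_comm (G : SimpleGraph V) (C D : Set V) : sepEdges G C D = sepEdges G D C := by
  ext e
  constructor <;>
  · rintro ⟨he, a, b, rfl, ha, hb⟩
    exact ⟨he, b, a, Sym2.eq_swap, hb, ha⟩

theorem sepElems_comm (G : SimpleGraph V) (C D : Set V) : sepElems G C D = sepElems G D C := by
  rw [sepElems, sepElems, sepEdges_comm, inter_comm]

theorem touching_comm (G : SimpleGraph V) (C D K : Set V) :
    touching G C D K = touching G D C K := by
  rw [touching, touching, sepElems_comm]

theorem encard_sepElems (G : SimpleGraph V) (C D : Set V) :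
    (sepElems G C D).encard = sepOrder G C D := by
  rw [sepElems, sepOrder, encard_union_eq, Sum.inl_injective.encard_image,
    Sum.inr_injective.encard_image]
  rw [Set.disjoint_left]
  rintro _ ⟨a, _, rfl⟩ ⟨b, _, h⟩
  cases h

theorem IsTetraSep.symm {G : SimpleGraph V} {C D : Set V} (h : IsTetraSep G C D) :
    IsTetraSep G D C := by
  obtain ⟨⟨h1, h2, h3⟩, h4, h5, h6⟩ := h
  refine ⟨⟨by rw [union_comm, h1], h3, h2⟩, ?_, ?_, ?_⟩
  · rw [← encard_sepElems, sepElems_comm, encard_sepElems, h4]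
  · exact fun v hv => ⟨(h5 v hv.symm).2, (h5 v hv.symm).1⟩
  · rw [MatchingCondition, sepEdges_comm]
    exact h6

theorem inl_mem_sepElems {G : SimpleGraph V} {C D : Set V} {v : V} :
    Sum.inl v ∈ sepElems G C D ↔ v ∈ C ∧ v ∈ D := by
  simp [sepElems]

theorem inr_mem_sepElems {G : SimpleGraph V} {C D : Set V} {a b : V} (hab : G.Adj a b)
    (ha : a ∈ C \ D) (hb : b ∈ D \ C) : Sum.inr s(a, b) ∈ sepElems G C D :=
  Or.inr ⟨_, ⟨hab, a, b, rfl, ha, hb⟩, rfl⟩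

theorem exists_far_end (G : SimpleGraph V) (C D : Set V) :
    ∃ f : V ⊕ Sym2 V → V, (∀ v, f (Sum.inl v) = v) ∧
      (∀ x ∈ sepElems G C D, f x ∈ hat x ∧ f x ∈ D) ∧
      ∀ a ∈ C \ D, ∀ b ∈ D \ C, f (Sum.inr s(a, b)) = b := by
  classical
  have h : ∀ x : V ⊕ Sym2 V, ∃ w, (∀ v, x = Sum.inl v → w = v) ∧
      (x ∈ sepElems G C D → w ∈ hat x ∧ w ∈ D) ∧
      ∀ a ∈ C \ D, ∀ b ∈ D \ C, x = Sum.inr s(a, b) → w = b := by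
    rintro (v | e)
    · refine ⟨v, by simp, ?_, by simp⟩
      intro hv
      exact ⟨rfl, (inl_mem_sepElems.1 hv).2⟩
    · by_cases he : ∃ a ∈ C \ D, ∃ b ∈ D \ C, e = s(a, b)
      · obtain ⟨a, ha, b, hb, rfl⟩ := he
        refine ⟨b, by simp, fun _ => ⟨Sym2.mem_mk_right a b, hb.1⟩, ?_⟩
        intro a' ha' b' hb' h
        rw [Sum.inr.injEq, Sym2.eq_iff] at h
        rcases h with ⟨_, h⟩ | ⟨h, _⟩
        · exact h
        · subst h
          exact absurd hb'.1 ha.2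
      · refine ⟨e.out.1, by simp, ?_, ?_⟩
        · rintro (⟨_, _, h⟩ | ⟨e', ⟨_, a, b, rfl, ha, hb⟩, h⟩)
          · cases h
          · cases h
            exact absurd ⟨a, ha, b, hb, rfl⟩ he
        · intro a ha b hb h
          cases h
          exact absurd ⟨a, ha, b, hb, rfl⟩ he
  choose f h1 h2 h3 using h
  exact ⟨f, fun v => h1 _ v rfl, h2, fun a ha b hb => h3 _ a ha b hb rfl⟩

theorem IsZone.hat_subset {G : SimpleGraph V} {Z K C D : Set V} (hK : IsZone G Z K)
    {x : V ⊕ Sym2 V} (hx : x ∈ touching G C D K) : ∀ v ∈ hat x, v ∈ K ∨ v ∈ Z := by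
  obtain ⟨hx, w, hw, hwK⟩ := hx
  rcases hx with ⟨u, hu, rfl⟩ | ⟨e, ⟨he, a, b, rfl, ha, hb⟩, rfl⟩
  · rintro v rfl
    cases hw
    exact Or.inl hwK
  · intro v hv
    have hab : G.Adj a b := he
    simp only [hat, mem_ofPred_eq, Sym2.mem_iff] at hw hv
    rcases hw with rfl | rfl <;> rcases hv with rfl | rfl
    · exact Or.inl hwK
    · exact hK.closed _ hwK _ hab
    · exact hK.closed _ hwK _ hab.symm
    · exact Or.inl hwK

theorem IsZone.not_mem_touching {G : SimpleGraph V} {Z K L C D : Set V} (hK : IsZone G Z K)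
    (hL : IsZone G Z L) (hKL : ∀ v ∈ K, v ∉ L) {x : V ⊕ Sym2 V}
    (hx : x ∈ touching G C D K) : x ∉ touching G C D L := by
  rintro ⟨_, w, hw, hwL⟩
  rcases hK.hat_subset hx w hw with h | h
  · exact hKL w h hwL
  · exact hL.notMem w hwL h

theorem IsZone.four_le {G : SimpleGraph V} (hG : KConnected G 4) {Z K : Set V}
    (hK : IsZone G Z K) {q : V} (hqK : q ∉ K) (hqZ : q ∉ Z) {C D : Set V}
    (hCD : C ∪ D = univ) {p : V} (hpK : p ∈ K) (hp : p ∈ C \ D) :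
    4 ≤ (Z ∩ (C \ D)).encard +
      (touching G C D K ∪ Sum.inl '' (Z ∩ (C ∩ D))).encard := by
  obtain ⟨f, hf1, hf2, hf3⟩ := exists_far_end G C D
  set T := touching G C D K ∪ Sum.inl '' (Z ∩ (C ∩ D)) with hT
  by_contra! hlt
  have hTs : T ⊆ sepElems G C D := by
    rintro x (hx | ⟨v, hv, rfl⟩)
    · exact hx.1
    · exact inl_mem_sepElems.2 hv.2
  have hX : (Z ∩ (C \ D) ∪ f '' T).encard < 4 :=
    ((encard_union_le _ _).trans (add_le_add le_rfl (encard_image_le f T))).trans_lt hlt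
  have hmem : ∀ x ∈ T, f x ∈ K ∨ f x ∈ Z := by
    rintro x (hx | ⟨v, hv, rfl⟩)
    · exact hK.hat_subset hx _ (hf2 x hx.1).1
    · rw [hf1]
      exact Or.inr hv.1
  refine hG.false_of_separates (P := K ∩ (C \ D)) hX ⟨hpK, hp⟩ ?_ (fun h => hqK h.1) ?_ ?_
  · rintro (h | ⟨x, hx, rfl⟩)
    · exact hK.notMem p hpK h.1
    · exact hp.2 (hf2 x (hTs hx)).2
  · rintro (h | ⟨x, hx, rfl⟩)
    · exact hqZ h.1
    · exact (hmem x hx).elim hqK hqZ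
  · rintro a ⟨haK, haC⟩ _ b hab
    have hb : b ∈ C ∨ b ∈ D := by
      have : b ∈ C ∪ D := hCD ▸ mem_univ b
      exact this
    by_cases hbD : b ∈ D
    · right; right
      by_cases hbC : b ∈ C
      · refine ⟨Sum.inl b, ?_, hf1 b⟩
        rcases hK.closed a haK b hab with h | h
        · exact Or.inl ⟨inl_mem_sepElems.2 ⟨hbC, hbD⟩, b, rfl, h⟩
        · exact Or.inr ⟨b, ⟨h, hbC, hbD⟩, rfl⟩
      · exact ⟨Sum.inr s(a, b), Or.inl ⟨inr_mem_sepElems hab haC ⟨hbD, hbC⟩, a,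
          Sym2.mem_mk_left a b, haK⟩, hf3 a haC b ⟨hbD, hbC⟩⟩
    · have hbC : b ∈ C \ D := ⟨hb.resolve_right hbD, hbD⟩
      rcases hK.closed a haK b hab with h | h
      · exact Or.inl ⟨h, hbC⟩
      · exact Or.inr (Or.inl ⟨h, hbC⟩)

theorem IsZone.side_eq_empty {G : SimpleGraph V} (hG : KConnected G 4) {Z K : Set V}
    (hK : IsZone G Z K) {q : V} (hqK : q ∉ K) (hqZ : q ∉ Z) {C D : Set V}
    (hCD : C ∪ D = univ) (hone : (touching G C D K).encard ≤ 1) (hZ0 : Z ∩ (C ∩ D) = ∅)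
    (hle : (Z ∩ (C \ D)).encard ≤ 2) : ∀ v ∈ K, v ∈ D := by
  intro v hvK
  by_contra hvD
  have hvC : v ∈ C := by
    have : v ∈ C ∪ D := hCD ▸ mem_univ v
    exact this.resolve_right hvD
  have h := hK.four_le hG hqK hqZ hCD hvK ⟨hvC, hvD⟩
  rw [hZ0, image_empty, union_empty] at h
  have h' := h.trans (add_le_add hle hone)
  exact absurd h' (by decide)

theorem exists_ne_of_two_le {s : Set V} (h : 2 ≤ s.encard) (a : V) : ∃ b ∈ s, b ≠ a := by
  have : 1 < s.encard := lt_of_lt_of_le (by decide) h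
  exact (one_lt_encard_iff_nontrivial.1 this).exists_ne a

theorem encard_right_le_two {s t : Set V} (h : (s ∪ t).encard = 4) (hd : Disjoint s t)
    (hs : 2 ≤ s.encard) : t.encard ≤ 2 := by
  rw [encard_union_eq hd] at h
  by_contra! ht
  have ht' : 3 ≤ t.encard := by
    exact Order.add_one_le_of_lt ht
  have := add_le_add hs ht'
  rw [h] at this
  exact absurd this (by decide)

theorem IsZone.false_of_small_side {G : SimpleGraph V} (hG : KConnected G 4) {Z K Q : Set V}
    (hZ : Z.encard = 4) (hK : IsZone G Z K) (hQ : IsZone G Z Q) (hKQ : ∀ v ∈ K, v ∉ Q)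
    (hnt : K.Nontrivial) {C D : Set V} (hT : IsTetraSep G C D)
    (hK1 : (touching G C D K).encard ≤ 1) (hQ1 : (touching G C D Q).encard ≤ 1)
    (hZ0 : Z ∩ (C ∩ D) = ∅) (hne : (Z ∩ (C \ D)).Nonempty)
    (hle : (Z ∩ (C \ D)).encard ≤ 2) : False := by
  obtain ⟨⟨hCD, -, -⟩, -, hdeg, hmat⟩ := hT
  obtain ⟨k, hk⟩ := hK.nonempty
  obtain ⟨q, hq⟩ := hQ.nonempty
  have hqK : q ∉ K := fun h => hKQ q h hq
  have hKD := hK.side_eq_empty hG hqK (hQ.notMem q hq) hCD hK1 hZ0 hle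
  have hQD := hQ.side_eq_empty hG (hKQ k hk) (hK.notMem k hk) hCD hQ1 hZ0 hle
  have hnbr : ∀ L : Set V, IsZone G Z L → (∀ v ∈ L, v ∈ D) → ∀ b ∈ L, b ∈ C →
      ∀ w ∈ G.neighborSet b ∩ (C \ D), w ∈ Z ∩ (C \ D) := by
    rintro L hL hLD b hb hbC w ⟨hbw, hw⟩
    rcases hL.closed b hb w hbw with h | h
    · exact absurd (hLD w h) hw.2
    · exact ⟨h, hw⟩
  have hKC : ∀ b ∈ K, b ∉ C := by
    intro b hb hbC
    have h2 : 2 ≤ (Z ∩ (C \ D)).encard :=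
      (hdeg b ⟨hbC, hKD b hb⟩).1.trans (encard_le_encard (hnbr K hK hKD b hb hbC))
    have hun : Z ∩ (C \ D) ∪ Z ∩ (D \ C) = Z := by
      ext z
      have h1 : z ∈ C ∪ D := hCD ▸ mem_univ z
      have h3 : ¬ (z ∈ Z ∩ (C ∩ D)) := by simp [hZ0]
      simp only [mem_union, mem_inter_iff, mem_sdiff] at h1 h3 ⊢
      tauto
    have hle' : (Z ∩ (D \ C)).encard ≤ 2 := by
      refine encard_right_le_two (by rw [hun, hZ]) ?_ h2
      rw [Set.disjoint_left]
      exact fun z h h' => h.2.2 h'.2.1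
    have hKC := hK.side_eq_empty hG hqK (hQ.notMem q hq) (by rw [union_comm, hCD])
      (by rwa [touching_comm]) (by rwa [inter_comm D C]) hle'
    obtain ⟨b', hb', hne'⟩ := hnt.exists_ne b
    have h := encard_le_one_iff.1 hK1 (Sum.inl b) (Sum.inl b')
      ⟨inl_mem_sepElems.2 ⟨hbC, hKD b hb⟩, b, rfl, hb⟩
      ⟨inl_mem_sepElems.2 ⟨hKC b' hb', hKD b' hb'⟩, b', rfl, hb'⟩
    exact hne' (Sum.inl_injective h).symm
  have hedge : ∀ z ∈ Z ∩ (C \ D), ∃ b ∈ K, b ∈ D \ C ∧ G.Adj z b := by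
    intro z hz
    obtain ⟨b, hb, hzb⟩ := hK.exists_adj hG hZ hqK (hQ.notMem q hq) hz.1
    exact ⟨b, hb, ⟨hKD b hb, hKC b hb⟩, hzb⟩
  have huniq : ∀ z ∈ Z ∩ (C \ D), ∀ z' ∈ Z ∩ (C \ D), z = z' := by
    intro z hz z' hz'
    obtain ⟨b, hb, hbD, hzb⟩ := hedge z hz
    obtain ⟨b', hb', hbD', hzb'⟩ := hedge z' hz'
    have h := encard_le_one_iff.1 hK1 (Sum.inr s(z, b)) (Sum.inr s(z', b'))
      ⟨inr_mem_sepElems hzb hz.2 hbD, b, Sym2.mem_mk_right z b, hb⟩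
      ⟨inr_mem_sepElems hzb' hz'.2 hbD', b', Sym2.mem_mk_right z' b', hb'⟩
    rw [Sum.inr.injEq, Sym2.eq_iff] at h
    rcases h with ⟨h, _⟩ | ⟨h, _⟩
    · exact h
    · rw [h] at hz
      exact absurd hb' (fun hb' => hK.notMem b' hb' hz.1)
  obtain ⟨z, hz⟩ := hne
  obtain ⟨b, hb, hbD, hzb⟩ := hedge z hz
  obtain ⟨c, hc, hzc⟩ := hQ.exists_adj hG hZ (hKQ k hk) (hK.notMem k hk) hz.1
  by_cases hcC : c ∈ C
  · obtain ⟨w, hw, hwz⟩ := exists_ne_of_two_le (hdeg c ⟨hcC, hQD c hc⟩).1 z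
    exact hwz (huniq w (hnbr Q hQ hQD c hc hcC w hw) z hz)
  · refine hmat s(z, b) ⟨hzb, z, b, rfl, hz.2, hbD⟩ s(z, c)
      ⟨hzc, z, c, rfl, hz.2, hQD c hc, hcC⟩ ?_ z (Sym2.mem_mk_left z b) (Sym2.mem_mk_left z c)
    intro h
    rw [Sym2.eq_iff] at h
    rcases h with ⟨_, h⟩ | ⟨_, h⟩
    · exact hKQ b hb (h ▸ hc)
    · exact hK.notMem b hb (h ▸ hz.1)

theorem IsZone.touching_nonempty {G : SimpleGraph V} (hG : KConnected G 4) {Z L : Set V}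
    (hZ : Z.encard = 4) (hL : IsZone G Z L) {q : V} (hqL : q ∉ L) (hqZ : q ∉ Z) {C D : Set V}
    (hCD : C ∪ D = univ) (hC : (Z ∩ (C \ D)).Nonempty) (hD : (Z ∩ (D \ C)).Nonempty) :
    (touching G C D L).Nonempty := by
  by_contra hemp
  have hno : ∀ x ∈ sepElems G C D, ∀ v ∈ hat x, v ∉ L :=
    fun x hx v hv hvL => hemp ⟨x, hx, v, hv, hvL⟩
  have hside : ∀ a ∈ L, ∀ b, G.Adj a b → b ∈ C \ D → a ∈ C \ D := by
    intro a ha b hab hb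
    have h1 : a ∈ C ∪ D := hCD ▸ mem_univ a
    have h2 : ¬ (a ∈ C ∧ a ∈ D) := fun h => hno _ (inl_mem_sepElems.2 h) a rfl ha
    have h3 : ¬ (a ∈ D \ C) := fun h =>
      hno _ (inr_mem_sepElems hab.symm hb h) a (Sym2.mem_mk_right b a) ha
    simp only [mem_union, mem_sdiff] at h1 h3 ⊢
    tauto
  obtain ⟨z, hz⟩ := hC
  obtain ⟨w, hw⟩ := hD
  obtain ⟨a, ha, hza⟩ := hL.exists_adj hG hZ hqL hqZ hz.1
  have hzone : IsZone G Z (L ∩ (C \ D)) := by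
    refine ⟨⟨a, ha, hside a ha z hza.symm hz.2⟩, fun v hv => hL.notMem v hv.1, ?_⟩
    rintro v ⟨hv, hvC⟩ b hvb
    rcases hL.closed v hv b hvb with h | h
    · exact Or.inl ⟨h, hside b h v hvb.symm hvC⟩
    · exact Or.inr h
  obtain ⟨b, hb, hwb⟩ := hzone.exists_adj hG hZ (fun h => hqL h.1) hqZ hw.1
  exact hno _ (inr_mem_sepElems hwb.symm hb.2 hw.2) b (Sym2.mem_mk_left b w) hb.1

theorem IsZone.not_both_sides {G : SimpleGraph V} (hG : KConnected G 4) {Z K Q R S : Set V}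
    (hZ : Z.encard = 4) (hK : IsZone G Z K) (hQ : IsZone G Z Q) (hR : IsZone G Z R)
    (hS : IsZone G Z S) (hKQ : ∀ v ∈ K, v ∉ Q) (hKR : ∀ v ∈ K, v ∉ R) (hKS : ∀ v ∈ K, v ∉ S)
    (hQR : ∀ v ∈ Q, v ∉ R) (hQS : ∀ v ∈ Q, v ∉ S) (hRS : ∀ v ∈ R, v ∉ S)
    (hnt : K.Nontrivial) {C D : Set V} (hT : IsTetraSep G C D)
    (hC : (Z ∩ (C \ D)).Nonempty) (hD : (Z ∩ (D \ C)).Nonempty) : False := by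
  obtain ⟨k, hk⟩ := hK.nonempty
  obtain ⟨q, hq⟩ := hQ.nonempty
  have hqK : q ∉ K := fun h => hKQ q h hq
  have hCD := hT.1.1
  obtain ⟨x, hx⟩ := hK.touching_nonempty hG hZ hqK (hQ.notMem q hq) hCD hC hD
  obtain ⟨y, hy⟩ := hQ.touching_nonempty hG hZ (hKQ k hk) (hK.notMem k hk) hCD hC hD
  obtain ⟨z, hz⟩ := hR.touching_nonempty hG hZ (hKR k hk) (hK.notMem k hk) hCD hC hD
  obtain ⟨w, hw⟩ := hS.touching_nonempty hG hZ (hKS k hk) (hK.notMem k hk) hCD hC hD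
  have nKQ : ∀ u ∈ touching G C D K, u ∉ touching G C D Q :=
    fun u hu => hK.not_mem_touching hQ hKQ hu
  have nKR : ∀ u ∈ touching G C D K, u ∉ touching G C D R :=
    fun u hu => hK.not_mem_touching hR hKR hu
  have nKS : ∀ u ∈ touching G C D K, u ∉ touching G C D S :=
    fun u hu => hK.not_mem_touching hS hKS hu
  have nQR : ∀ u ∈ touching G C D Q, u ∉ touching G C D R :=
    fun u hu => hQ.not_mem_touching hR hQR hu
  have nQS : ∀ u ∈ touching G C D Q, u ∉ touching G C D S :=
    fun u hu => hQ.not_mem_touching hS hQS hu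
  have nRS : ∀ u ∈ touching G C D R, u ∉ touching G C D S :=
    fun u hu => hR.not_mem_touching hS hRS hu
  have h4 : ({x, y, z, w} : Set (V ⊕ Sym2 V)).encard = 4 := by
    rw [encard_insert_of_notMem, encard_insert_of_notMem, encard_pair]
    · rfl
    · rintro rfl; exact nRS _ hz hw
    · simp only [mem_insert_iff, mem_singleton_iff, not_or]
      exact ⟨by rintro rfl; exact nQR _ hy hz, by rintro rfl; exact nQS _ hy hw⟩
    · simp only [mem_insert_iff, mem_singleton_iff, not_or]
      exact ⟨by rintro rfl; exact nKQ _ hx hy, by rintro rfl; exact nKR _ hx hz,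
        by rintro rfl; exact nKS _ hx hw⟩
  have hall : ({x, y, z, w} : Set (V ⊕ Sym2 V)) = sepElems G C D := by
    refine Finite.eq_of_subset_of_encard_le' (finite_of_encard_eq_coe (k := 4) ?_) ?_ ?_
    · rw [encard_sepElems, hT.2.1]
      rfl
    · rintro u (rfl | rfl | rfl | rfl)
      exacts [hx.1, hy.1, hz.1, hw.1]
    · rw [encard_sepElems, hT.2.1, h4]
  have hmem : ∀ u ∈ sepElems G C D, u = x ∨ u = y ∨ u = z ∨ u = w := by
    intro u hu
    rw [← hall] at hu
    exact hu
  have hK1 : ∀ u ∈ touching G C D K, u = x := by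
    intro u hu
    rcases hmem u hu.1 with rfl | rfl | rfl | rfl
    exacts [rfl, absurd hy (nKQ _ hu), absurd hz (nKR _ hu), absurd hw (nKS _ hu)]
  have hQ1 : ∀ u ∈ touching G C D Q, u = y := by
    intro u hu
    rcases hmem u hu.1 with rfl | rfl | rfl | rfl
    exacts [absurd hu (nKQ _ hx), rfl, absurd hz (nQR _ hu), absurd hw (nQS _ hu)]
  have hK1' : (touching G C D K).encard ≤ 1 :=
    encard_le_one_iff.2 fun a b ha hb => (hK1 a ha).trans (hK1 b hb).symm
  have hQ1' : (touching G C D Q).encard ≤ 1 :=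
    encard_le_one_iff.2 fun a b ha hb => (hQ1 a ha).trans (hQ1 b hb).symm
  have hnot : ∀ L : Set V, IsZone G Z L → ∀ v ∈ Z, Sum.inl v ∉ touching G C D L := by
    rintro L hL v hv ⟨_, u, hu, huL⟩
    cases hu
    exact hL.notMem v huL hv
  have hZ0 : Z ∩ (C ∩ D) = ∅ := by
    rw [eq_empty_iff_forall_notMem]
    rintro v ⟨hv, hvCD⟩
    rcases hmem _ (inl_mem_sepElems.2 hvCD) with h | h | h | h
    exacts [hnot K hK v hv (h ▸ hx), hnot Q hQ v hv (h ▸ hy), hnot R hR v hv (h ▸ hz),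
      hnot S hS v hv (h ▸ hw)]
  by_cases hle : (Z ∩ (C \ D)).encard ≤ 2
  · exact hK.false_of_small_side hG hZ hQ hKQ hnt hT hK1' hQ1' hZ0 hC hle
  · have hle' : (Z ∩ (D \ C)).encard ≤ 2 := by
      refine encard_right_le_two (s := Z ∩ (C \ D)) ?_ ?_ (not_le.1 hle).le
      · rw [← hZ]
        congr 1
        ext v
        have h1 : v ∈ C ∪ D := hCD ▸ mem_univ v
        have h3 : ¬ (v ∈ Z ∩ (C ∩ D)) := by simp [hZ0]
        simp only [mem_union, mem_inter_iff, mem_sdiff] at h1 h3 ⊢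
        tauto
      · rw [Set.disjoint_left]
        exact fun z h h' => h.2.2 h'.2.1
    exact hK.false_of_small_side hG hZ hQ hKQ hnt hT.symm (by rwa [touching_comm])
      (by rwa [touching_comm]) (by rwa [inter_comm D C]) hD hle'

theorem IsZone.sepElems_eq {G : SimpleGraph V} (hG : KConnected G 4) {Z K : Set V}
    (hK : IsZone G Z K) {q : V} (hqK : q ∉ K) (hqZ : q ∉ Z) {C D : Set V}
    (hT : IsTetraSep G C D) (hZC : Z ∩ (C \ D) = ∅) {p : V} (hpK : p ∈ K) (hp : p ∈ C \ D) :
    touching G C D K ∪ Sum.inl '' (Z ∩ (C ∩ D)) = sepElems G C D := by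
  refine Finite.eq_of_subset_of_encard_le' (finite_of_encard_eq_coe (k := 4) ?_) ?_ ?_
  · rw [encard_sepElems, hT.2.1]
    rfl
  · rintro x (hx | ⟨v, hv, rfl⟩)
    · exact hx.1
    · exact inl_mem_sepElems.2 hv.2
  · have h := hK.four_le hG hqK hqZ hT.1.1 hpK hp
    rwa [hZC, encard_empty, zero_add, ← hT.2.1, ← encard_sepElems] at h

theorem IsZone.nested_of_side_eq_empty {G : SimpleGraph V} (hG : KConnected G 4) {Z K A : Set V}
    (hZ : Z.encard = 4) (hK : IsZone G Z K)
    (hconn : ∀ s : Set V, (∀ a ∈ K, ∀ b ∈ K, G.Adj a b → a ∈ s → b ∈ s) →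
      ∀ v ∈ K, v ∈ s → K ⊆ s)
    (hKA : K ⊆ A) (hAK : A ⊆ K ∪ Z) (hA : ∀ z ∈ Z, 2 ≤ (G.neighborSet z ∩ K).encard → z ∈ A)
    {C D : Set V} (hT : IsTetraSep G C D) (hZC : Z ∩ (C \ D) = ∅) : Nested A Kᶜ C D := by
  have hCD : ∀ v, v ∈ C ∨ v ∈ D := by
    intro v
    have : v ∈ C ∪ D := hT.1.1 ▸ mem_univ v
    exact this
  have hZD : ∀ z ∈ Z, z ∈ D := by
    intro z hz
    by_contra hzD
    have : z ∈ Z ∩ (C \ D) := ⟨hz, (hCD z).resolve_right hzD, hzD⟩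
    simp [hZC] at this
  by_cases hKD : K ⊆ D
  · right; left
    constructor
    · intro a ha
      exact (hAK ha).elim (fun h => hKD h) (hZD a)
    · intro v hv hvK
      obtain ⟨w, ⟨hvw, hw⟩, -⟩ := exists_ne_of_two_le (hT.2.2.1 v ⟨hv, hKD hvK⟩).1 v
      exact hw.2 ((hK.closed v hvK w hvw).elim (fun h => hKD h) (hZD w))
  by_cases hCK : C \ D ⊆ K
  · right; right; right
    constructor
    · intro v hv
      by_contra hvD
      exact hv (hCK ⟨(hCD v).resolve_right hvD, hvD⟩)
    · intro v hv
      by_cases hvD : v ∈ D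
      · by_cases hvK : v ∈ K
        · exact hKA hvK
        · have h2 := (hT.2.2.1 v ⟨hv, hvD⟩).1
          obtain ⟨w, ⟨hvw, hw⟩, -⟩ := exists_ne_of_two_le h2 v
          have hvZ : v ∈ Z := (hK.closed w (hCK hw) v hvw.symm).resolve_left hvK
          exact hA v hvZ (h2.trans (encard_le_encard (inter_subset_inter_right _ hCK)))
      · exact hKA (hCK ⟨hv, hvD⟩)
  left
  obtain ⟨p, hpK, hpD⟩ := not_subset.1 hKD
  obtain ⟨q, hqC, hqK⟩ := not_subset.1 hCK
  have hp : p ∈ C \ D := ⟨(hCD p).resolve_right hpD, hpD⟩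
  have hqZ : q ∉ Z := fun h => hqC.2 (hZD q h)
  have hL : IsZone G Z (K ∪ Z)ᶜ := by
    refine ⟨⟨q, fun h => h.elim hqK hqZ⟩, fun v hv hvZ => hv (Or.inr hvZ), ?_⟩
    intro a ha b hab
    by_cases hbZ : b ∈ Z
    · exact Or.inr hbZ
    · refine Or.inl fun hb => ha ?_
      exact hK.closed b (hb.resolve_right hbZ) a hab.symm
  have h1 := hK.sepElems_eq hG hqK hqZ hT hZC hpK hp
  have h2 := hL.sepElems_eq hG (q := p) (fun h => h (Or.inl hpK)) (hK.notMem p hpK) hT hZC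
    (fun h => h.elim hqK hqZ) hqC
  have hsub : ∀ x ∈ sepElems G C D, x ∈ Sum.inl '' (Z ∩ (C ∩ D)) := by
    intro x hx
    have hx1 := hx
    have hx2 := hx
    rw [← h1] at hx1
    rw [← h2] at hx2
    rcases hx1 with hx1 | hx1
    · rcases hx2 with hx2 | hx2
      · exact absurd hx2 (hK.not_mem_touching hL (fun v hv h => h (Or.inl hv)) hx1)
      · exact hx2
    · exact hx1
  have hZCD : Z ∩ (C ∩ D) = Z := by
    refine Finite.eq_of_subset_of_encard_le'
      (finite_of_encard_eq_coe (k := 4) hZ) inter_subset_left ?_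
    rw [hZ, ← hT.2.1, ← encard_sepElems,
      ← (Sum.inl_injective (α := V) (β := Sym2 V)).encard_image]
    exact encard_le_encard hsub
  have hKC : K ⊆ C \ D := by
    refine hconn _ ?_ p hpK hp
    intro a ha b hb hab haC
    have hbCD : ¬ (b ∈ C ∧ b ∈ D) := by
      intro h
      obtain ⟨v, hv, hvb⟩ := hsub _ (inl_mem_sepElems.2 h)
      cases hvb
      exact hK.notMem b hb hv.1
    have hbD : ¬ (b ∈ D \ C) := by
      intro h
      obtain ⟨v, hv, hvb⟩ := hsub _ (inr_mem_sepElems hab haC h)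
      cases hvb
    have := hCD b
    simp only [mem_sdiff] at hbD ⊢
    tauto
  constructor
  · intro a ha
    rcases hAK ha with h | h
    · exact (hKC h).1
    · rw [← hZCD] at h
      exact h.2.1
  · exact fun v hv hvK => (hKC hvK).2 hv

/-- The vertices reachable from `u` by walks whose further vertices avoid `Z`. -/
def componentAvoiding (G : SimpleGraph V) (Z : Set V) (u : V) : Set V :=
  {v | Relation.ReflTransGen (fun a b => G.Adj a b ∧ b ∉ Z) u v}

theorem isZone_componentAvoiding (G : SimpleGraph V) {Z : Set V} {u : V} (hu : u ∉ Z) :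
    IsZone G Z (componentAvoiding G Z u) := by
  refine ⟨⟨u, .refl⟩, ?_, ?_⟩
  · intro v hv
    induction hv with
    | refl => exact hu
    | tail _ h _ => exact h.2
  · intro a ha b hab
    by_cases hb : b ∈ Z
    · exact Or.inr hb
    · exact Or.inl (Relation.ReflTransGen.tail ha ⟨hab, hb⟩)

theorem componentAvoiding_subset_of_closed {G : SimpleGraph V} {Z : Set V} {u : V} {s : Set V}
    (hs : ∀ a ∈ componentAvoiding G Z u, ∀ b ∈ componentAvoiding G Z u,
      G.Adj a b → a ∈ s → b ∈ s) {v : V} (hv : v ∈ componentAvoiding G Z u) (hvs : v ∈ s) :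
    componentAvoiding G Z u ⊆ s := by
  have hmem : ∀ w ∈ componentAvoiding G Z u, (w ∈ s ↔ u ∈ s) := by
    intro w hw
    induction hw with
    | refl => exact Iff.rfl
    | @tail b c hb hbc ih =>
      have hc : c ∈ componentAvoiding G Z u := Relation.ReflTransGen.tail hb hbc
      rw [← ih]
      exact ⟨hs c hc b hb hbc.1.symm, hs b hb c hc hbc.1⟩
  exact fun w hw => (hmem w hw).2 ((hmem v hv).1 hvs)

theorem IsZone.componentAvoiding_subset {G : SimpleGraph V} {Z Q : Set V} (hQ : IsZone G Z Q)
    {u : V} (hu : u ∈ Q) : componentAvoiding G Z u ⊆ Q :=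
  componentAvoiding_subset_of_closed
    (fun a _ b hb hab haQ => (hQ.closed a haQ b hab).resolve_right
      ((isZone_componentAvoiding G (hQ.notMem u hu)).notMem b hb)) .refl hu

theorem IsZone.isTetraSep {G : SimpleGraph V} (hG : KConnected G 4) {Z K Q R : Set V}
    (hZ : Z.encard = 4) (hK : IsZone G Z K) (hQ : IsZone G Z Q) (hR : IsZone G Z R)
    (hKQ : ∀ v ∈ K, v ∉ Q) (hKR : ∀ v ∈ K, v ∉ R) (hQR : ∀ v ∈ Q, v ∉ R)
    (hnt : K.Nontrivial) :
    IsTetraSep G (K ∪ {z ∈ Z | 2 ≤ (G.neighborSet z ∩ K).encard}) Kᶜ := by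
  obtain ⟨k, hk⟩ := hK.nonempty
  obtain ⟨q, hq⟩ := hQ.nonempty
  have hqK : q ∉ K := fun h => hKQ q h hq
  have hqZ := hQ.notMem q hq
  have hKZ := hK.notMem
  set Y := {z ∈ Z | 2 ≤ (G.neighborSet z ∩ K).encard}
  have hYZ : ∀ y ∈ Y, y ∈ Z := fun y hy => hy.1
  have hAB : (K ∪ Y) \ Kᶜ = K := by
    ext v
    simp only [mem_sdiff, mem_union, mem_compl_iff]
    tauto
  have hBA : Kᶜ \ (K ∪ Y) = (K ∪ Y)ᶜ := by
    ext v
    simp only [mem_sdiff, mem_union, mem_compl_iff]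
    tauto
  have hI : (K ∪ Y) ∩ Kᶜ = Y := by
    ext v
    have h1 := hYZ v
    have h2 := hKZ v
    simp only [mem_inter_iff, mem_union, mem_compl_iff]
    tauto
  have hnb : ∀ z, ∃ b, z ∈ Z → b ∈ K ∧ G.Adj z b := by
    intro z
    by_cases hz : z ∈ Z
    · obtain ⟨b, hb, hzb⟩ := hK.exists_adj hG hZ hqK hqZ hz
      exact ⟨b, fun _ => ⟨hb, hzb⟩⟩
    · exact ⟨z, fun h => absurd h hz⟩
  choose n hn using hnb
  have huniq : ∀ z ∈ Z \ Y, ∀ b ∈ K, G.Adj z b → b = n z := by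
    rintro z ⟨hz, hzY⟩ b hb hzb
    have hlt : (G.neighborSet z ∩ K).encard < 2 := not_le.1 fun h => hzY ⟨hz, h⟩
    have hle : (G.neighborSet z ∩ K).encard ≤ 1 := Order.le_of_lt_add_one hlt
    exact encard_le_one_iff.1 hle b (n z) ⟨hzb, hb⟩ ⟨(hn z hz).2, (hn z hz).1⟩
  have hE : sepEdges G (K ∪ Y) Kᶜ = (fun z => s(n z, z)) '' (Z \ Y) := by
    ext e
    rw [sepEdges, hAB, hBA]
    constructor
    · rintro ⟨hab, a, b, rfl, ha, hb⟩
      have hab' : G.Adj a b := hab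
      have hbZ : b ∈ Z := (hK.closed a ha b hab').resolve_left fun h => hb (Or.inl h)
      have hbZY : b ∈ Z \ Y := ⟨hbZ, fun h => hb (Or.inr h)⟩
      exact ⟨b, hbZY, by rw [huniq b hbZY a ha hab'.symm]⟩
    · rintro ⟨z, hz, rfl⟩
      exact ⟨(hn z hz.1).2.symm, n z, z, rfl, (hn z hz.1).1,
        fun h => h.elim (fun h => hKZ z h hz.1) hz.2⟩
  have hcross : ∀ z ∈ Z, ∀ z' ∈ Z, n z ≠ z' := fun z hz z' hz' h =>
    hKZ _ (hn z hz).1 (h ▸ hz')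
  have hinj : InjOn (fun z => s(n z, z)) (Z \ Y) := by
    intro z hz z' hz' h
    rcases Sym2.eq_iff.1 h with ⟨_, h⟩ | ⟨h, _⟩
    · exact h
    · exact absurd h (hcross z hz.1 z' hz'.1)
  have hninj : ∀ z ∈ Z \ Y, ∀ z' ∈ Z \ Y, n z = n z' → z = z' := by
    intro z hz z' hz' hzz'
    by_contra hne
    obtain ⟨k', hk', hk'n⟩ := hnt.exists_ne (n z)
    have h2 : (Z \ {z, z'}).encard + 2 = 4 := by
      rw [← encard_pair hne, ← hZ]
      exact encard_sdiff_add_encard_of_subset (insert_subset hz.1 (singleton_subset_iff.2 hz'.1))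
    have h2' : (Z \ {z, z'}).encard ≤ 2 :=
      (ENat.add_le_add_iff_right (k := 2) (by decide)).1 (le_of_eq h2)
    have hX : (insert (n z) (Z \ {z, z'})).encard < 4 :=
      ((encard_insert_le _ _).trans (add_le_add h2' le_rfl)).trans_lt (by decide)
    refine hG.false_of_separates hX hk' ?_ hqK ?_ ?_
    · rintro (h | h)
      · exact hk'n h
      · exact hKZ k' hk' h.1
    · rintro (h | h)
      · exact hqK (h ▸ (hn z hz.1).1)
      · exact hqZ h.1
    · intro a ha haX b hab
      rcases hK.closed a ha b hab with hb | hb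
      · exact Or.inl hb
      · refine Or.inr (Or.inr ⟨hb, ?_⟩)
        rintro (rfl | rfl)
        · exact haX (Or.inl (huniq b hz a ha hab.symm))
        · exact haX (Or.inl ((huniq b hz' a ha hab.symm).trans hzz'.symm))
  refine ⟨⟨?_, ?_, ?_⟩, ?_, ?_, ?_⟩
  · ext v
    simp only [mem_union, mem_compl_iff, mem_univ, iff_true]
    tauto
  · rw [hAB]
    exact hK.nonempty
  · rw [hBA]
    exact ⟨q, fun h => h.elim hqK fun h => hqZ h.1⟩
  · rw [sepOrder, hI, hE, hinj.encard_image, ← hZ, add_comm]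
    exact encard_sdiff_add_encard_of_subset hYZ
  · intro v hv
    rw [hI] at hv
    rw [hAB, hBA]
    refine ⟨hv.2, ?_⟩
    obtain ⟨b, hb, hvb⟩ := hQ.exists_adj hG hZ (hKQ k hk) (hKZ k hk) hv.1
    obtain ⟨c, hc, hvc⟩ := hR.exists_adj hG hZ (hKR k hk) (hKZ k hk) hv.1
    have hne : b ≠ c := by
      rintro rfl
      exact hQR b hb hc
    rw [← encard_pair hne]
    refine encard_le_encard ?_
    rintro w (rfl | rfl)
    · exact ⟨hvb, fun h => h.elim (fun h => hKQ w h hb) fun h => hQ.notMem w hb h.1⟩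
    · exact ⟨hvc, fun h => h.elim (fun h => hKR w h hc) fun h => hR.notMem w hc h.1⟩
  · rw [MatchingCondition, hE]
    rintro _ ⟨z, hz, rfl⟩ _ ⟨z', hz', rfl⟩ hne v hv hv'
    simp only [Sym2.mem_iff] at hv hv'
    refine hne ?_
    have hzz' : z = z' := by
      rcases hv with rfl | rfl <;> rcases hv' with h | h
      · exact hninj z hz z' hz' h
      · exact absurd h (hcross z hz.1 z' hz'.1)
      · exact absurd h.symm (hcross z' hz'.1 v hz.1)
      · exact h
    rw [hzz']

theorem Nested.swap_right {A B C D : Set V} (h : Nested A B D C) : Nested A B C D := by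
  unfold Nested at *
  tauto

theorem FourAngry.neighbors_of_zones {G : SimpleGraph V} (hG : FourAngry G) {Z P Q R S : Set V}
    (hZ : Z.encard = 4) (hP : IsZone G Z P) (hQ : IsZone G Z Q) (hR : IsZone G Z R)
    (hS : IsZone G Z S) (hPQ : ∀ v ∈ P, v ∉ Q) (hPR : ∀ v ∈ P, v ∉ R) (hPS : ∀ v ∈ P, v ∉ S)
    (hQR : ∀ v ∈ Q, v ∉ R) (hQS : ∀ v ∈ Q, v ∉ S) (hRS : ∀ v ∈ R, v ∉ S) :
    ∀ u ∈ P, ∀ v, G.Adj u v ↔ v ∈ Z := by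
  intro u hu
  have hKP := hP.componentAvoiding_subset hu
  have hK := isZone_componentAvoiding G (hP.notMem u hu)
  set K := componentAvoiding G Z u
  have huK : u ∈ K := Relation.ReflTransGen.refl
  obtain ⟨q, hq⟩ := hQ.nonempty
  have hqK : q ∉ K := fun h => hPQ q (hKP h) hq
  have hsub : K.Subsingleton := by
    by_contra hnt
    rw [not_subsingleton_iff] at hnt
    have hKQ : ∀ v ∈ K, v ∉ Q := fun v hv => hPQ v (hKP hv)
    have hKR : ∀ v ∈ K, v ∉ R := fun v hv => hPR v (hKP hv)
    have hKS : ∀ v ∈ K, v ∉ S := fun v hv => hPS v (hKP hv)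
    obtain ⟨C, D, hT, hcr⟩ := hG.2 _ _ (hK.isTetraSep hG.1 hZ hQ hR hKQ hKR hQR hnt)
    have hnest : ∀ C D : Set V, IsTetraSep G C D → Z ∩ (C \ D) = ∅ →
        Nested (K ∪ {z ∈ Z | 2 ≤ (G.neighborSet z ∩ K).encard}) Kᶜ C D := fun C D hT h =>
      hK.nested_of_side_eq_empty hG.1 hZ
        (fun s hs v hv hvs => componentAvoiding_subset_of_closed hs hv hvs) subset_union_left
        (union_subset_union_right K fun z hz => hz.1)
        (fun z hz h => mem_union_right K (mem_sep hz h)) hT h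
    rcases eq_empty_or_nonempty (Z ∩ (C \ D)) with hC | hC
    · exact hcr (hnest C D hT hC)
    rcases eq_empty_or_nonempty (Z ∩ (D \ C)) with hD | hD
    · exact hcr (hnest D C hT.symm hD).swap_right
    exact hK.not_both_sides hG.1 hZ hQ hR hS hKQ hKR hKS hQR hQS hRS hnt hT hC hD
  intro v
  constructor
  · intro huv
    refine (hK.closed u huK v huv).resolve_left fun hv => ?_
    exact G.ne_of_adj huv (hsub huK hv)
  · intro hv
    obtain ⟨b, hb, hvb⟩ := hK.exists_adj hG.1 hZ hqK (hQ.notMem q hq) hv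
    rw [hsub huK hb]
    exact hvb.symm

theorem exists_four_of_le_encard {s : Set V} (h : 4 ≤ s.encard) :
    ∃ p q r t : V, p ∈ s ∧ q ∈ s ∧ r ∈ s ∧ t ∈ s ∧
      p ≠ q ∧ p ≠ r ∧ p ≠ t ∧ q ≠ r ∧ q ≠ t ∧ r ≠ t := by
  obtain ⟨t, hts, ht⟩ := exists_subset_encard_eq h
  obtain ⟨p, q, r, u, hpq, hpr, hpu, hqr, hqu, hru, rfl⟩ := encard_eq_four.1 ht
  exact ⟨p, q, r, u, hts (by simp), hts (by simp), hts (by simp), hts (by simp),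
    hpq, hpr, hpu, hqr, hqu, hru⟩

theorem IsTetraSep.sepEdges_eq_empty {G : SimpleGraph V} {A B : Set V} (h : IsTetraSep G A B)
    (hZ : (A ∩ B).encard = 4) : sepEdges G A B = ∅ := by
  have h4 := h.2.1
  rw [sepOrder, hZ] at h4
  rw [← encard_eq_zero]
  exact (ENat.addLECancellable_of_ne_top (a := 4) (by decide)).inj.1 (h4.trans (add_zero 4).symm)

theorem mem_corner_of_notMem {A B C D : Set V} (hAB : A ∪ B = univ) (hCD : C ∪ D = univ)
    (hZ : A ∩ B = C ∩ D) {v : V} (hv : v ∉ A ∩ B) :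
    v ∈ corner A B C D ∨ v ∈ corner A B D C ∨ v ∈ corner B A C D ∨ v ∈ corner B A D C := by
  have h1 : v ∈ A ∪ B := hAB ▸ mem_univ v
  have h2 : v ∈ C ∪ D := hCD ▸ mem_univ v
  have h3 : v ∉ C ∩ D := hZ ▸ hv
  simp only [corner, mem_inter_iff, mem_sdiff, mem_union] at *
  tauto

theorem isZone_corner {G : SimpleGraph V} {A B C D : Set V} (hAB : A ∪ B = univ)
    (hCD : C ∪ D = univ) (hZ : A ∩ B = C ∩ D) (hE : sepEdges G A B = ∅)
    (hF : sepEdges G C D = ∅) (hne : (corner A B C D).Nonempty) :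
    IsZone G (A ∩ B) (corner A B C D) := by
  refine ⟨hne, fun v hv h => hv.1.2 h.2, ?_⟩
  intro a ha b hab
  have h1 : b ∉ B \ A := by
    intro hb
    have : s(a, b) ∈ sepEdges G A B := ⟨hab, a, b, rfl, ha.1, hb⟩
    simp [hE] at this
  have h2 : b ∉ D \ C := by
    intro hb
    have : s(a, b) ∈ sepEdges G C D := ⟨hab, a, b, rfl, ha.2, hb⟩
    simp [hF] at this
  by_cases hb : b ∈ A ∩ B
  · exact Or.inr hb
  · left
    rcases mem_corner_of_notMem hAB hCD hZ hb with h | h | h | h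
    exacts [h, absurd h.2 h2, absurd h.1 h1, absurd h.1 h1]

theorem not_adj_of_link_eq_empty {G : SimpleGraph V} {A B C D : Set V}
    (hl : link G A B C D = ∅) {a b : V} (ha : a ∈ corner A B C D) (hb : b ∈ corner B A C D) :
    ¬ G.Adj a b := by
  intro hab
  have : Sum.inr s(a, b) ∈ link G A B C D := by
    refine Or.inr ⟨_, ⟨⟨hab, a, b, rfl, ha.1, hb.1⟩, ?_, a, Sym2.mem_mk_left a b, Or.inl ha⟩, rfl⟩
    rintro ⟨-, c, d, h, h'⟩
    rcases Sym2.eq_iff.1 h with ⟨rfl, rfl⟩ | ⟨rfl, rfl⟩ <;> rcases h' with ⟨hc, hd⟩ | ⟨hc, hd⟩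
    exacts [hd.2.2 hb.2.1, hc.2.2 ha.2.1, hd.2.2 ha.2.1, hc.2.2 hb.2.1]
  simp [hl] at this

theorem corner_comm (A B C D : Set V) : corner A B C D = corner C D A B :=
  inter_comm _ _

theorem inter_subset_of_link_eq_empty {G : SimpleGraph V} {A B C D : Set V}
    (hCD : C ∪ D = univ) (hlC : link G A B C D = ∅) (hlD : link G A B D C = ∅) :
    A ∩ B ⊆ C ∩ D := by
  intro v hv
  have h1 : v ∈ C ∪ D := hCD ▸ mem_univ v
  have h2 : ¬ (v ∈ C \ D) := by
    intro h
    have : Sum.inl v ∈ link G A B C D := Or.inl ⟨v, ⟨h, hv⟩, rfl⟩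
    simp [hlC] at this
  have h3 : ¬ (v ∈ D \ C) := by
    intro h
    have : Sum.inl v ∈ link G A B D C := Or.inl ⟨v, ⟨h, hv⟩, rfl⟩
    simp [hlD] at this
  simp only [mem_inter_iff, mem_sdiff, mem_union] at *
  tauto

theorem inter_eq_inter_of_link_eq_empty {G : SimpleGraph V} {A B C D : Set V}
    (hAB : A ∪ B = univ) (hCD : C ∪ D = univ)
    (hlA : link G C D A B = ∅) (hlB : link G C D B A = ∅)
    (hlC : link G A B C D = ∅) (hlD : link G A B D C = ∅) : A ∩ B = C ∩ D :=
  (inter_subset_of_link_eq_empty hCD hlC hlD).antisymm (inter_subset_of_link_eq_empty hAB hlA hlB)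

theorem corner_nonempty_of_not_leSep {A B C D : Set V} (hAB : A ∪ B = univ)
    (hCD : C ∪ D = univ) (hZ : A ∩ B = C ∩ D) (h : ¬ LeSep A B C D) :
    (corner A B D C).Nonempty := by
  have key : ∀ v, (v ∈ A ∧ v ∉ C) ∨ (v ∈ D ∧ v ∉ B) → v ∈ corner A B D C := by
    intro v hv
    have h1 : v ∈ A ∪ B := hAB ▸ mem_univ v
    have h2 : v ∈ C ∪ D := hCD ▸ mem_univ v
    have h3 : v ∈ A ∩ B ↔ v ∈ C ∩ D := by rw [hZ]
    simp only [corner, mem_inter_iff, mem_sdiff, mem_union] at *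
    tauto
  by_contra hne
  exact h ⟨fun v hv => by_contra fun h' => hne ⟨v, key v (Or.inl ⟨hv, h'⟩)⟩,
    fun v hv => by_contra fun h' => hne ⟨v, key v (Or.inr ⟨hv, h'⟩)⟩⟩

theorem corners_nonempty {A B C D : Set V} (hAB : A ∪ B = univ) (hCD : C ∪ D = univ)
    (hZ : A ∩ B = C ∩ D) (h : Crosses A B C D) :
    (corner A B D C).Nonempty ∧ (corner A B C D).Nonempty ∧
      (corner B A D C).Nonempty ∧ (corner B A C D).Nonempty := by
  simp only [Crosses, Nested, not_or] at h
  have hBA : B ∪ A = univ := by rw [union_comm, hAB]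
  have hDC : D ∪ C = univ := by rw [union_comm, hCD]
  have hZ' : B ∩ A = C ∩ D := by rw [inter_comm, hZ]
  exact ⟨corner_nonempty_of_not_leSep hAB hCD hZ h.1,
    corner_nonempty_of_not_leSep hAB hDC (by rw [hZ, inter_comm]) h.2.1,
    corner_nonempty_of_not_leSep hBA hCD hZ' h.2.2.1,
    corner_nonempty_of_not_leSep hBA hDC (by rw [hZ', inter_comm]) h.2.2.2⟩

theorem encard_inter_of_link_eq_empty {G : SimpleGraph V} (hG : KConnected G 4)
    {A B C D : Set V} (hAB : IsTetraSep G A B) (hCD : IsTetraSep G C D)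
    (hcr : Crosses A B C D) (hZ : A ∩ B = C ∩ D)
    (hlA : link G C D A B = ∅) (hlB : link G C D B A = ∅)
    (hlC : link G A B C D = ∅) (hlD : link G A B D C = ∅) : (A ∩ B).encard = 4 := by
  have hle : (A ∩ B).encard ≤ 4 := by
    rw [← hAB.2.1, sepOrder]
    exact le_self_add
  refine hle.eq_of_not_lt fun hlt => ?_
  obtain ⟨⟨q, hq⟩, ⟨p, hp⟩, -, -⟩ := corners_nonempty hAB.1.1 hCD.1.1 hZ hcr
  refine hG.false_of_separates (P := corner A B C D ∪ corner B A D C) hlt (Or.inl hp)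
    (fun h => hp.1.2 h.2) ?_ (fun h => hq.1.2 h.2) ?_
  · rintro (h | h)
    · exact hq.2.2 h.2.1
    · exact hq.1.2 h.1.1
  · intro a ha _ b hab
    by_cases hb : b ∈ A ∩ B
    · exact Or.inr hb
    refine Or.inl ?_
    rcases mem_corner_of_notMem hAB.1.1 hCD.1.1 hZ hb with h | h | h | h
    · exact Or.inl h
    · rcases ha with ha | ha
      · rw [corner_comm] at ha h
        exact absurd hab (not_adj_of_link_eq_empty hlA ha h)
      · exact absurd hab.symm (not_adj_of_link_eq_empty hlD h ha)
    · rcases ha with ha | ha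
      · exact absurd hab (not_adj_of_link_eq_empty hlC ha h)
      · rw [corner_comm] at ha h
        exact absurd hab.symm (not_adj_of_link_eq_empty hlB h ha)
    · exact Or.inr h

theorem isTetraSep_union_pair {G : SimpleGraph V} {X : Set V} (hX : X.encard = 4)
    (hind : ∀ a b : V, a ∉ X → b ∉ X → ¬ G.Adj a b) (hcomp : ∀ a : V, a ∉ X → ∀ x ∈ X, G.Adj a x)
    {p q r s : V} (hp : p ∉ X) (hq : q ∉ X) (hr : r ∉ X) (hs : s ∉ X) (hpq : p ≠ q)
    (hrs : r ≠ s) (hpr : p ≠ r) (hps : p ≠ s) (hqr : q ≠ r) (hqs : q ≠ s) :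
    IsTetraSep G (X ∪ {p, q}) {p, q}ᶜ := by
  have hI : (X ∪ {p, q}) ∩ {p, q}ᶜ = X := by
    ext v
    simp only [mem_inter_iff, mem_union, mem_insert_iff, mem_singleton_iff, mem_compl_iff]
    grind
  have hA : (X ∪ {p, q}) \ {p, q}ᶜ = {p, q} := by
    ext v
    simp only [mem_sdiff, mem_union, mem_compl_iff, not_not]
    exact and_iff_right_of_imp Or.inr
  have hB : {p, q}ᶜ \ (X ∪ {p, q}) = (X ∪ {p, q})ᶜ := by
    ext v
    simp only [mem_sdiff, mem_union, mem_compl_iff]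
    tauto
  have hrB : r ∈ (X ∪ {p, q})ᶜ := by simp [hr, hpr.symm, hqr.symm]
  have hsB : s ∈ (X ∪ {p, q})ᶜ := by simp [hs, hps.symm, hqs.symm]
  have hE : sepEdges G (X ∪ {p, q}) {p, q}ᶜ = ∅ := by
    rw [sepEdges, hA, hB, eq_empty_iff_forall_notMem]
    rintro _ ⟨hab, a, b, rfl, ha, hb⟩
    refine hind a b ?_ (fun h => hb (Or.inl h)) hab
    rcases ha with rfl | rfl
    exacts [hp, hq]
  refine ⟨⟨?_, ?_, ?_⟩, ?_, ?_, ?_⟩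
  · ext v
    simp only [mem_union, mem_compl_iff, mem_univ, iff_true]
    tauto
  · rw [hA]
    exact ⟨p, Or.inl rfl⟩
  · rw [hB]
    exact ⟨r, hrB⟩
  · rw [sepOrder, hI, hE, encard_empty, add_zero, hX]
  · intro v hv
    rw [hI] at hv
    rw [hA, hB]
    constructor
    · rw [← encard_pair hpq]
      refine encard_le_encard ?_
      rintro w (rfl | rfl)
      · exact ⟨(hcomp _ hp v hv).symm, Or.inl rfl⟩
      · exact ⟨(hcomp _ hq v hv).symm, Or.inr rfl⟩
    · rw [← encard_pair hrs]
      refine encard_le_encard ?_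
      rintro w (rfl | rfl)
      · exact ⟨(hcomp _ hr v hv).symm, hrB⟩
      · exact ⟨(hcomp _ hs v hv).symm, hsB⟩
  · rw [MatchingCondition, hE]
    exact fun e he => absurd he (notMem_empty e)

/-- a 4-angry graph has two tetra-separations crossing with all
links empty iff it is a sprinkled K₄,ₘ with m ≥ 4. -/
theorem four_angry_sprinkled_K4m (G : SimpleGraph V) (hG : FourAngry G) :
    (∃ A B C D : Set V, IsTetraSep G A B ∧ IsTetraSep G C D ∧ Crosses A B C D ∧
        link G C D A B = ∅ ∧ link G C D B A = ∅ ∧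
        link G A B C D = ∅ ∧ link G A B D C = ∅) ↔
      ∃ m : ℕ∞, 4 ≤ m ∧ IsSprinkledK4m G m := by
  constructor
  · rintro ⟨A, B, C, D, hAB, hCD, hcr, hlA, hlB, hlC, hlD⟩
    have hZ := inter_eq_inter_of_link_eq_empty hAB.1.1 hCD.1.1 hlA hlB hlC hlD
    have hZ4 := encard_inter_of_link_eq_empty hG.1 hAB hCD hcr hZ hlA hlB hlC hlD
    have hE := hAB.sepEdges_eq_empty hZ4
    have hF := hCD.sepEdges_eq_empty (hZ ▸ hZ4)
    obtain ⟨hAD, hAC, hBD, hBC⟩ := corners_nonempty hAB.1.1 hCD.1.1 hZ hcr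
    have hE' : sepEdges G B A = ∅ := by rw [sepEdges_comm, hE]
    have hF' : sepEdges G D C = ∅ := by rw [sepEdges_comm, hF]
    have zAC := isZone_corner hAB.1.1 hCD.1.1 hZ hE hF hAC
    have zAD := isZone_corner hAB.1.1 (by rw [union_comm, hCD.1.1])
      (by rw [hZ, inter_comm]) hE hF' hAD
    have zBC := isZone_corner (by rw [union_comm, hAB.1.1]) hCD.1.1
      (by rw [inter_comm, hZ]) hE' hF hBC
    have zBD := isZone_corner (by rw [union_comm, hAB.1.1]) (by rw [union_comm, hCD.1.1])
      (by rw [inter_comm, hZ, inter_comm]) hE' hF' hBD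
    rw [inter_comm B A] at zBC zBD
    have hdisj : (∀ v ∈ corner A B C D, v ∉ corner A B D C) ∧
        (∀ v ∈ corner A B C D, v ∉ corner B A C D) ∧
        (∀ v ∈ corner A B C D, v ∉ corner B A D C) ∧
        (∀ v ∈ corner A B D C, v ∉ corner B A C D) ∧
        (∀ v ∈ corner A B D C, v ∉ corner B A D C) ∧
        (∀ v ∈ corner B A C D, v ∉ corner B A D C) := by
      simp only [corner, mem_inter_iff, mem_sdiff]
      grind
    obtain ⟨d1, d2, d3, d4, d5, d6⟩ := hdisj
    have hsymm : ∀ {P Q : Set V}, (∀ v ∈ P, v ∉ Q) → ∀ v ∈ Q, v ∉ P :=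
      fun h v hv hv' => h v hv' hv
    have hnb : ∀ u, u ∉ A ∩ B → ∀ v, G.Adj u v ↔ v ∈ A ∩ B := by
      intro u hu
      rcases mem_corner_of_notMem hAB.1.1 hCD.1.1 hZ hu with h | h | h | h
      · exact hG.neighbors_of_zones hZ4 zAC zAD zBC zBD d1 d2 d3 d4 d5 d6 u h
      · exact hG.neighbors_of_zones hZ4 zAD zAC zBC zBD (hsymm d1) d4 d5 d2 d3 d6 u h
      · exact hG.neighbors_of_zones hZ4 zBC zAC zAD zBD (hsymm d2) (hsymm d4) d6 d1 d3 d5 u h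
      · exact hG.neighbors_of_zones hZ4 zBD zAC zAD zBC (hsymm d3) (hsymm d5) (hsymm d6)
          d1 d2 d4 u h
    refine ⟨_, ?_, A ∩ B, hZ4, rfl, fun a b ha hb hab => hb ((hnb a ha b).1 hab),
      fun a ha x hx => (hnb a ha x).2 hx⟩
    obtain ⟨a, ha⟩ := hAC
    obtain ⟨b, hb⟩ := hAD
    obtain ⟨c, hc⟩ := hBC
    obtain ⟨d, hd⟩ := hBD
    have h4 : ({a, b, c, d} : Set V).encard = 4 := by
      refine encard_eq_four.2 ⟨a, b, c, d, ?_, ?_, ?_, ?_, ?_, ?_, rfl⟩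
      exacts [fun h => d1 a ha (h ▸ hb), fun h => d2 a ha (h ▸ hc), fun h => d3 a ha (h ▸ hd),
        fun h => d4 b hb (h ▸ hc), fun h => d5 b hb (h ▸ hd), fun h => d6 c hc (h ▸ hd)]
    rw [← h4]
    refine encard_le_encard ?_
    rintro v (rfl | rfl | rfl | rfl)
    exacts [zAC.notMem _ ha, zAD.notMem _ hb, zBC.notMem _ hc, zBD.notMem _ hd]
  · rintro ⟨m, hm, X, hX, rfl, hind, hcomp⟩
    obtain ⟨p, q, r, s, hp, hq, hr, hs, hpq, hpr, hps, hqr, hqs, hrs⟩ :=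
      exists_four_of_le_encard hm
    have hI : ∀ a ∉ X, ∀ b ∉ X, (X ∪ {a, b}) ∩ {a, b}ᶜ = X := by
      intro a ha b hb
      ext v
      simp only [mem_inter_iff, mem_union, mem_insert_iff, mem_singleton_iff, mem_compl_iff]
      grind
    have hlink : ∀ {A B C D : Set V}, A ∩ B = X → C ∩ D = X → sepEdges G A B = ∅ →
        link G A B C D = ∅ := by
      intro A B C D h h' hE
      have : (C \ D) ∩ (A ∩ B) = ∅ := by
        rw [h, ← h', eq_empty_iff_forall_notMem]
        exact fun v hv => hv.1.2 hv.2.2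
      simp [link, this, hE]
    have t1 := isTetraSep_union_pair hX hind hcomp hp hq hr hs hpq hrs hpr hps hqr hqs
    have t2 := isTetraSep_union_pair hX hind hcomp hp hr hq hs hpr hqs hpq hps hqr.symm hrs
    have i1 := hI p hp q hq
    have i2 := hI p hp r hr
    have e1 := t1.sepEdges_eq_empty (by rw [i1, hX])
    have e2 := t2.sepEdges_eq_empty (by rw [i2, hX])
    refine ⟨_, _, _, _, t1, t2, ?_, hlink i2 i1 e2, hlink i2 (by rw [inter_comm, i1]) e2,
      hlink i1 i2 e1, hlink i1 (by rw [inter_comm, i2]) e1⟩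
    rintro (⟨h, -⟩ | ⟨h, -⟩ | ⟨h, -⟩ | ⟨h, -⟩)
    · have := @h q
      grind
    · have := @h p
      grind
    · have := @h s
      grind
    · have := @h r
      grind

end Paper
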